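/- Let X be a (0,1)-matrix of order n ≥ 2 with total support, and let G be the bipartite graph whose reduced adjacency matrix is X. Then G is connected if and only if X is fully indecomposable. -/

import Mathlib

open SimpleGraph

/-- A stable (independent) set of vertices: pairwise nonadjacent. -/
def IsStableSet {V : Type*} (G : SimpleGraph V) (S : Set V) : Prop :=
  S.Pairwise fun u v => ¬ G.Adj u v

/-- The stability number `α(G)`: maximum cardinality of a stable set. -/
noncomputable def stabNum {V : Type*} (G : SimpleGraph V) : ℕ :=
  sSup {k | ∃ S : Set V, IsStableSet G S ∧ S.ncard = k}

/-- A maximum stable set. -/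
def IsMaxStableSet {V : Type*} (G : SimpleGraph V) (S : Set V) : Prop :=
  IsStableSet G S ∧ S.ncard = stabNum G

/-- `G` is α⁺-stable: adding any edge between nonadjacent vertices keeps α. -/
def AlphaPlusStable {V : Type*} (G : SimpleGraph V) : Prop :=
  ∀ x y : V, x ≠ y → ¬ G.Adj x y →
    stabNum (G ⊔ SimpleGraph.fromEdgeSet {s(x, y)}) = stabNum G

/-- `G` is α⁻-stable: deleting any edge keeps α. -/
def AlphaMinusStable {V : Type*} (G : SimpleGraph V) : Prop :=
  ∀ e ∈ G.edgeSet, stabNum (G.deleteEdges {e}) = stabNum G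

/-- `G` is α-stable: both α⁺-stable and α⁻-stable. -/
def AlphaStable {V : Type*} (G : SimpleGraph V) : Prop :=
  AlphaPlusStable G ∧ AlphaMinusStable G

/-- `{A, B}` is a bipartition of `G`. -/
def IsBipartition {V : Type*} (G : SimpleGraph V) (A B : Set V) : Prop :=
  Disjoint A B ∧ A ∪ B = Set.univ ∧
    ∀ ⦃x y⦄, G.Adj x y → (x ∈ A ∧ y ∈ B) ∨ (x ∈ B ∧ y ∈ A)

/-- `G` is bistable bipartite w.r.t. bipartition `{A, B}`:
`A` and `B` are its only maximum stable sets. -/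
def BistableBipartite {V : Type*} (G : SimpleGraph V) (A B : Set V) : Prop :=
  IsBipartition G A B ∧ ∀ S : Set V, IsMaxStableSet G S ↔ S = A ∨ S = B

/-- `G` has a perfect matching. -/
def HasPerfectMatching {V : Type*} (G : SimpleGraph V) : Prop :=
  ∃ M : G.Subgraph, M.IsPerfectMatching

/-- `X` has a `k` by `n - k` zero submatrix for some `1 ≤ k ≤ n - 1`. -/
def HasZeroSubmatrix {m : Type*} [Fintype m] (X : Matrix m m ℕ) : Prop :=
  ∃ R C : Finset m, R.Nonempty ∧ C.Nonempty ∧ R.card + C.card = Fintype.card m ∧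
    ∀ i ∈ R, ∀ j ∈ C, X i j = 0

/-- A square matrix is partly decomposable. -/
def PartlyDecomposable {m : Type*} [Fintype m] (X : Matrix m m ℕ) : Prop :=
  (Fintype.card m = 1 ∧ ∀ i j, X i j = 0) ∨ HasZeroSubmatrix X

/-- A square matrix is fully indecomposable iff it is not partly decomposable. -/
def FullyIndecomposable {m : Type*} [Fintype m] (X : Matrix m m ℕ) : Prop :=
  ¬ PartlyDecomposable X

/-- A (0,1)-matrix. -/
def ZeroOne {m k : Type*} (X : Matrix m k ℕ) : Prop :=
  ∀ i j, X i j = 0 ∨ X i j = 1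

/-- The term rank: maximal number of nonzero entries, no two on a line. -/
noncomputable def termRank {m k : Type*} [Fintype m] [Fintype k] (X : Matrix m k ℕ) : ℕ :=
  sSup {r | ∃ (f : Fin r ↪ m) (g : Fin r ↪ k), ∀ i, X (f i) (g i) ≠ 0}

/-- The permanent of a square matrix with natural entries. -/
def perm {m : Type*} [Fintype m] [DecidableEq m] (X : Matrix m m ℕ) : ℕ :=
  ∑ σ : Equiv.Perm m, ∏ i, X (σ i) i

/-- The bipartite graph whose reduced adjacency matrix is the (0,1)-matrix `X`. -/
def matGraph {ι κ : Type*} (X : Matrix ι κ ℕ) : SimpleGraph (ι ⊕ κ) :=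
  SimpleGraph.fromRel fun u v => ∃ i j, u = Sum.inl i ∧ v = Sum.inr j ∧ X i j = 1

/-- A square (0,1)-matrix has total support provided each of its `1`'s belongs to a
nonzero diagonal. -/
def TotalSupport {n : ℕ} (X : Matrix (Fin n) (Fin n) ℕ) : Prop :=
  ∀ i j, X i j = 1 → ∃ σ : Equiv.Perm (Fin n), σ i = j ∧ ∀ k, X k (σ k) ≠ 0


lemma matGraph_adj_lr {n : ℕ} (X : Matrix (Fin n) (Fin n) ℕ) (i j : Fin n) (h : X i j = 1) :
    (matGraph X).Adj (Sum.inl i) (Sum.inr j) := by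
  simp [matGraph, h]

lemma matGraph_closed {n : ℕ} (X : Matrix (Fin n) (Fin n) ℕ) (P : Fin n ⊕ Fin n → Prop)
    (h : ∀ i j, X i j = 1 → (P (Sum.inl i) ↔ P (Sum.inr j))) {u v : Fin n ⊕ Fin n}
    (hr : (matGraph X).Reachable u v) : P u ↔ P v := by
  obtain ⟨w⟩ := hr
  induction w with
  | nil => rfl
  | cons hadj _ ih =>
    rw [← ih]
    rw [matGraph, SimpleGraph.fromRel_adj] at hadj
    rcases hadj.2 with ⟨i, j, rfl, rfl, hx⟩ | ⟨i, j, rfl, rfl, hx⟩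
    · exact h i j hx
    · exact (h i j hx).symm

/-- Let `X` be a (0,1)-matrix of order `n ≥ 2` with total support and
`G` the bipartite graph whose reduced adjacency matrix is `X`. Then `G` is connected iff
`X` is fully indecomposable. -/
theorem stmt_11 {n : ℕ} (hn : 2 ≤ n) (X : Matrix (Fin n) (Fin n) ℕ) (h01 : ZeroOne X)
    (hts : TotalSupport X) :
    (matGraph X).Connected ↔ FullyIndecomposable X := by
  classical
  constructor
  · rintro hc (⟨h1, -⟩ | ⟨R, C, ⟨r, hr⟩, ⟨c, hcC⟩, hcard, hz⟩)
    · simp at h1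
      omega
    · have key := matGraph_closed X (fun w => Sum.elim (fun i => i ∈ R) (fun j => j ∉ C) w) ?_
        (hc.preconnected (Sum.inl r) (Sum.inr c))
      · simp [hr, hcC] at key
      · intro i j hij
        simp only [Sum.elim_inl, Sum.elim_inr]
        constructor
        · intro hi hj
          have := hz i hi j hj
          omega
        · intro hj
          obtain ⟨σ, hσ, hnz⟩ := hts i j hij
          have hsub : R.image σ ⊆ Cᶜ := by
            intro y hy
            obtain ⟨x, hx, rfl⟩ := Finset.mem_image.1 hy
            rw [Finset.mem_compl]
            intro hy
            exact hnz x (hz x hx _ hy)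
          have heq : R.image σ = Cᶜ := by
            apply Finset.eq_of_subset_of_card_le hsub
            rw [Finset.card_image_of_injective _ σ.injective, Finset.card_compl]
            omega
          have hj' : j ∈ R.image σ := by rw [heq]; simpa using hj
          obtain ⟨x, hx, hxj⟩ := Finset.mem_image.1 hj'
          have : x = i := σ.injective (hxj.trans hσ.symm)
          exact this ▸ hx
  · intro hfi
    by_contra hnc
    apply hfi
    right
    by_cases h0 : ∀ i j, X i j = 0
    · have h0n : 0 < n := by omega
      refine ⟨{⟨0, h0n⟩}, {⟨0, h0n⟩}ᶜ, by simp, ⟨⟨1, by omega⟩, by simp [Fin.ext_iff]⟩, ?_, ?_⟩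
      · exact Finset.card_add_card_compl _
      · intros; apply h0
    · push Not at h0
      obtain ⟨a, b, hab⟩ := h0
      obtain ⟨σ, -, hσ⟩ := hts a b ((h01 a b).resolve_left hab)
      have hσ1 : ∀ k, (matGraph X).Adj (Sum.inl k) (Sum.inr (σ k)) := fun k =>
        matGraph_adj_lr X _ _ ((h01 _ _).resolve_left (hσ k))
      have hnp : ∃ u v, ¬ (matGraph X).Reachable u v := by
        by_contra hcon
        push Not at hcon
        exact hnc { preconnected := hcon, nonempty := ⟨Sum.inl a⟩ }
      obtain ⟨u, v, huv⟩ := hnp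
      have hiff : ∀ k, (matGraph X).Reachable u (Sum.inl k) ↔
          (matGraph X).Reachable u (Sum.inr (σ k)) := fun k =>
        ⟨fun h => h.trans (hσ1 k).reachable, fun h => h.trans (hσ1 k).symm.reachable⟩
      let R : Finset (Fin n) := Finset.univ.filter fun i => (matGraph X).Reachable u (Sum.inl i)
      have hR : ∀ i, i ∈ R ↔ (matGraph X).Reachable u (Sum.inl i) := by simp [R]
      have hC : ∀ j, j ∈ (R.image σ)ᶜ ↔ ¬ (matGraph X).Reachable u (Sum.inr j) := by
        intro j
        obtain ⟨i, rfl⟩ := σ.surjective j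
        rw [← hiff, ← hR]
        simp
      refine ⟨R, (R.image σ)ᶜ, ?_, ?_, ?_, ?_⟩
      · rcases u with i | j
        · exact ⟨i, (hR i).2 (SimpleGraph.Reachable.refl _)⟩
        · obtain ⟨i, rfl⟩ := σ.surjective j
          exact ⟨i, (hR i).2 ((hiff i).2 (SimpleGraph.Reachable.refl _))⟩
      · rcases v with i | j
        · exact ⟨σ i, (hC _).2 (by rwa [← hiff])⟩
        · exact ⟨j, (hC _).2 huv⟩
      · rw [← Finset.card_add_card_compl (R.image σ),
          Finset.card_image_of_injective _ σ.injective]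
      · intro i hi j hj
        refine (h01 i j).resolve_right fun h1 => (hC j).1 hj ?_
        exact ((hR i).1 hi).trans (matGraph_adj_lr X i j h1).reachable
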